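/- Let γ > 0 and let A ∈ C^γ(Σ, SL₂(ℝ)) be γ-fiber bunched. Then for every x ∈ Σ and every y ∈ W^s_loc(x), the limit H^s_{x,y} := lim_{n→∞} (A^n(y))^{-1} A^n(x) exists in SL₂(ℝ); there exists a constant L > 0 such that ‖H^s_{x,y} − Id‖ ≤ L·d(x,y)^γ for all such pairs (x,y); and the family satisfies H^s_{x,x} = Id, H^s_{x,y} = H^s_{z,y} ∘ H^s_{x,z} for every z ∈ W^s_loc(x), and H^s_{σ(x),σ(y)} = A(y) H^s_{x,y} A(x)^{-1}. (Existence of stable linear holonomies for fiber-bunched cocycles.) -/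

import Mathlib

open MeasureTheory

noncomputable section

abbrev Mat2 : Type := Matrix (Fin 2) (Fin 2) ℝ
abbrev SL2 : Type := Matrix.SpecialLinearGroup (Fin 2) ℝ
abbrev E2 : Type := EuclideanSpace ℝ (Fin 2)
abbrev Pone : Type := Projectivization ℝ E2

instance : TopologicalSpace SL2 :=
  inferInstanceAs (TopologicalSpace { A : Mat2 // A.det = 1 })

/-- The operator norm of a 2×2 real matrix, acting on Euclidean ℝ². -/
def opNorm (M : Mat2) : ℝ := ‖Matrix.toEuclideanCLM (𝕜 := ℝ) M‖

/-- The continuous linear map on Euclidean ℝ² induced by a matrix in SL₂(ℝ). -/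
def toEuc (g : SL2) : E2 →L[ℝ] E2 := Matrix.toEuclideanCLM (𝕜 := ℝ) (g : Mat2)

lemma toEuc_injective (g : SL2) : Function.Injective (toEuc g) := by
  intro x y hxy
  have key : ∀ z, toEuc g⁻¹ (toEuc g z) = z := by
    intro z
    have h1 : ((g⁻¹ : SL2) : Mat2) * (g : Mat2) = 1 := by
      rw [← Matrix.SpecialLinearGroup.coe_mul, inv_mul_cancel,
        Matrix.SpecialLinearGroup.coe_one]
    calc toEuc g⁻¹ (toEuc g z)
        = (Matrix.toEuclideanCLM (𝕜 := ℝ) (((g⁻¹ : SL2) : Mat2) * (g : Mat2))) z := by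
          rw [map_mul]; rfl
      _ = z := by rw [h1, map_one]; rfl
  have := congrArg (toEuc g⁻¹) hxy
  rwa [key, key] at this

/-- The projective action of SL₂(ℝ) on the real projective line ℙ¹. -/
def pact (g : SL2) : Pone → Pone :=
  Projectivization.map (toEuc g).toLinearMap (toEuc_injective g)

instance : MeasurableSpace Pone :=
  inferInstanceAs (MeasurableSpace (Quotient (projectivizationSetoid ℝ E2)))

instance : TopologicalSpace Pone :=
  inferInstanceAs (TopologicalSpace (Quotient (projectivizationSetoid ℝ E2)))

/-- The space `Σ = {1,…,κ}^ℤ` of bilateral sequences in `κ` symbols. -/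
abbrev Sig (κ : ℕ) : Type := ℤ → Fin κ

/-- The left shift map `σ((x_n)_n) = (x_{n+1})_n`. -/
def shift {κ : ℕ} (x : Sig κ) : Sig κ := fun n => x (n + 1)

/-- The cocycle iterates: `A^n(x) = A(σ^{n-1}x) ⋯ A(σ x) A(x)`. -/
def cocycleN {κ : ℕ} (A : Sig κ → SL2) : ℕ → Sig κ → SL2
  | 0, _ => 1
  | n + 1, x => cocycleN A n (shift x) * A x

/-- `μ` is the Bernoulli measure `p^ℤ` on `Σ`: a probability measure giving each
cylinder its product measure. -/
def IsBernoulli {κ : ℕ} (p : Fin κ → ℝ) (μ : Measure (Sig κ)) : Prop :=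
  IsProbabilityMeasure μ ∧
    ∀ (s : Finset ℤ) (a : ℤ → Fin κ),
      μ {x | ∀ n ∈ s, x n = a n} = ∏ n ∈ s, ENNReal.ofReal (p (a n))

/-- The Lyapunov exponent `L(A) = inf_{n ≥ 1} (1/n) ∫_Σ log‖A^n(x)‖ dμ(x)`. -/
def lyap {κ : ℕ} (μ : Measure (Sig κ)) (A : Sig κ → SL2) : ℝ :=
  ⨅ n : {m : ℕ // 0 < m},
    (((n : ℕ) : ℝ))⁻¹ * ∫ x, Real.log (opNorm ((cocycleN A (n : ℕ) x : SL2) : Mat2)) ∂μ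

/-- The first position (in absolute value) at which two sequences differ. -/
def firstDiff {κ : ℕ} (x y : Sig κ) : ℕ :=
  sInf {m : ℕ | x (m : ℤ) ≠ y (m : ℤ) ∨ x (-(m : ℤ)) ≠ y (-(m : ℤ))}

open Classical in
/-- The distance `d(x,y) = ζ^{-N(x,y)}` on `Σ`. -/
def dSig {κ : ℕ} (ζ : ℝ) (x y : Sig κ) : ℝ :=
  if x = y then 0 else ζ ^ (-(firstDiff x y : ℤ))

/-- `A` is a cocycle with finite γ-Hölder seminorm w.r.t. the metric `dSig ζ`,
i.e. `A ∈ C^γ(Σ, SL₂(ℝ))`. -/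
def HolderCocycle {κ : ℕ} (ζ γ : ℝ) (A : Sig κ → SL2) : Prop :=
  ∃ H : ℝ, ∀ x y : Sig κ, x ≠ y →
    opNorm ((A x : Mat2) - (A y : Mat2)) ≤ H * (dSig ζ x y) ^ γ

/-- `‖A − B‖_{C^γ} < ε`: there are a bound on the sup distance and a bound on the
γ-Hölder seminorm of the difference, summing to less than `ε`. -/
def CgammaClose {κ : ℕ} (ζ γ : ℝ) (A B : Sig κ → SL2) (ε : ℝ) : Prop :=
  ∃ C₁ C₂ : ℝ, C₁ + C₂ < ε ∧
    (∀ x, opNorm ((A x : Mat2) - (B x : Mat2)) ≤ C₁) ∧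
    (∀ x y : Sig κ, x ≠ y →
      opNorm (((A x : Mat2) - (B x : Mat2)) - ((A y : Mat2) - (B y : Mat2)))
        ≤ C₂ * (dSig ζ x y) ^ γ)

/-- `A` is γ-fiber bunched: for some `n ≥ 1`, `sup_{x ∈ Σ} ‖A^n(x)‖² < ζ^{nγ}`. -/
def FiberBunched {κ : ℕ} (ζ γ : ℝ) (A : Sig κ → SL2) : Prop :=
  ∃ n : ℕ, 0 < n ∧ ∃ c : ℝ, c < ζ ^ ((n : ℝ) * γ) ∧
    ∀ x : Sig κ, (opNorm ((cocycleN A n x : SL2) : Mat2)) ^ 2 ≤ c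

/-- `y` is in the local stable set of `x`: the two sequences agree in all
nonnegative coordinates. -/
def WsLoc {κ : ℕ} (x y : Sig κ) : Prop := ∀ n : ℤ, 0 ≤ n → y n = x n

lemma opNorm_nonneg (M : Mat2) : 0 ≤ opNorm M := norm_nonneg _

lemma opNorm_mul_le (M N : Mat2) : opNorm (M * N) ≤ opNorm M * opNorm N := by
  unfold opNorm
  rw [map_mul]
  exact norm_mul_le _ _

lemma opNorm_one : opNorm 1 = 1 := by
  unfold opNorm
  rw [map_one]
  exact norm_one

lemma opNorm_transpose (M : Mat2) : opNorm M.transpose = opNorm M := by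
  unfold opNorm
  have : M.transpose = star M := by
    ext i j
    simp [Matrix.star_apply]
  rw [this, map_star]
  exact norm_star (E := E2 →L[ℝ] E2) _

def JJ : Mat2 := !![0, 1; -1, 0]

lemma opNorm_JJ_sq : opNorm JJ * opNorm JJ = 1 := by
  have h : opNorm (star JJ * JJ) = opNorm JJ * opNorm JJ := by
    unfold opNorm
    rw [map_mul, map_star]
    exact CStarRing.norm_star_mul_self (E := E2 →L[ℝ] E2)
  rw [← h, ← opNorm_one]
  congr 1
  ext i j
  fin_cases i <;> fin_cases j <;> simp [JJ, Matrix.mul_apply, Matrix.star_apply]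

lemma opNorm_inv_le (g : SL2) : opNorm ((g⁻¹ : SL2) : Mat2) ≤ opNorm (g : Mat2) := by
  have h : ((g⁻¹ : SL2) : Mat2) = JJ * ((g : Mat2).transpose * JJ.transpose) := by
    rw [Matrix.SpecialLinearGroup.coe_inv, Matrix.adjugate_fin_two]
    ext i j
    fin_cases i <;> fin_cases j <;> simp [JJ, Matrix.mul_apply]
  rw [h]
  calc _ ≤ opNorm JJ * (opNorm (g : Mat2).transpose * opNorm JJ.transpose) :=
        (opNorm_mul_le _ _).trans
          (mul_le_mul_of_nonneg_left (opNorm_mul_le _ _) (opNorm_nonneg _))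
    _ = opNorm (g : Mat2) * (opNorm JJ * opNorm JJ) := by
        rw [opNorm_transpose, opNorm_transpose]; ring
    _ = _ := by rw [opNorm_JJ_sq, mul_one]

lemma cocycleN_add {κ : ℕ} (A : Sig κ → SL2) (m n : ℕ) (x : Sig κ) :
    cocycleN A (m + n) x = cocycleN A m (shift^[n] x) * cocycleN A n x := by
  induction n generalizing x with
  | zero => simp [cocycleN]
  | succ n ih =>
    rw [← add_assoc]
    simp only [cocycleN]
    rw [ih, Function.iterate_succ_apply, mul_assoc]

lemma cocycleN_succ' {κ : ℕ} (A : Sig κ → SL2) (n : ℕ) (x : Sig κ) :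
    cocycleN A (n + 1) x = A (shift^[n] x) * cocycleN A n x := by
  rw [add_comm, cocycleN_add]
  simp [cocycleN]

lemma WsLoc.shift' {κ : ℕ} {x y : Sig κ} (h : WsLoc x y) : WsLoc (shift x) (shift y) :=
  fun n hn => h (n + 1) (by omega)

lemma dSig_nonneg {κ : ℕ} {ζ : ℝ} (hζ : 1 < ζ) (x y : Sig κ) : 0 ≤ dSig ζ x y := by
  unfold dSig
  split_ifs
  · exact le_rfl
  · positivity

lemma dSig_le_one {κ : ℕ} {ζ : ℝ} (hζ : 1 < ζ) (x y : Sig κ) : dSig ζ x y ≤ 1 := by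
  unfold dSig
  split_ifs
  · exact zero_le_one
  · rw [zpow_neg, zpow_natCast]
    exact inv_le_one_of_one_le₀ (one_le_pow₀ hζ.le)

lemma dSig_shift {κ : ℕ} {ζ : ℝ} (hζ : 1 < ζ) {x y : Sig κ} (h : WsLoc x y) :
    dSig ζ (shift x) (shift y) ≤ ζ⁻¹ * dSig ζ x y := by
  have hζ0 : 0 < ζ := by linarith
  by_cases hs : shift x = shift y
  · have : dSig ζ (shift x) (shift y) = 0 := by simp [dSig, hs]
    rw [this]
    exact mul_nonneg (by positivity) (dSig_nonneg hζ _ _)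
  · have hne : x ≠ y := fun e => hs (by rw [e])
    have key : firstDiff x y + 1 ≤ firstDiff (shift x) (shift y) := by
      have hne' : {m : ℕ | shift x (m : ℤ) ≠ shift y (m : ℤ) ∨
          shift x (-(m : ℤ)) ≠ shift y (-(m : ℤ))}.Nonempty := by
        by_contra hc
        apply hs
        funext n
        by_contra hn
        apply hc
        refine ⟨n.natAbs, ?_⟩
        rcases Int.natAbs_eq n with e | e
        · left; rw [← e]; exact hn
        · right; rw [← e]; exact hn
      have hm := Nat.sInf_mem hne'
      change shift x (firstDiff (shift x) (shift y) : ℤ) ≠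
          shift y (firstDiff (shift x) (shift y) : ℤ) ∨
        shift x (-(firstDiff (shift x) (shift y) : ℤ)) ≠
          shift y (-(firstDiff (shift x) (shift y) : ℤ)) at hm
      generalize firstDiff (shift x) (shift y) = m at hm
      rcases hm with hm | hm
      · exact absurd (h ((m : ℤ) + 1) (by positivity)).symm hm
      · have hpos : 1 ≤ m := by
          by_contra hlt
          exact hm (h (-(m : ℤ) + 1) (by omega)).symm
        obtain ⟨k, rfl⟩ : ∃ k, m = k + 1 := ⟨m - 1, by omega⟩
        have : firstDiff x y ≤ k := by
          apply Nat.sInf_le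
          right
          have e : (-((k + 1 : ℕ) : ℤ)) + 1 = -(k : ℤ) := by push_cast; ring
          simpa only [shift, e] using hm
        omega
    unfold dSig
    rw [if_neg hs, if_neg hne, zpow_neg, zpow_neg, zpow_natCast, zpow_natCast, ← mul_inv,
      ← pow_succ']
    exact inv_anti₀ (by positivity) (pow_le_pow_right₀ hζ.le key)

lemma dSig_iter {κ : ℕ} {ζ : ℝ} (hζ : 1 < ζ) (n : ℕ) {x y : Sig κ} (h : WsLoc x y) :
    dSig ζ (shift^[n] x) (shift^[n] y) ≤ (ζ⁻¹) ^ n * dSig ζ x y := by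
  have hζ0 : 0 < ζ := by linarith
  induction n generalizing x y with
  | zero => simp
  | succ n ih =>
    rw [Function.iterate_succ_apply, Function.iterate_succ_apply]
    refine (ih h.shift').trans ?_
    rw [pow_succ, mul_assoc]
    exact mul_le_mul_of_nonneg_left (dSig_shift hζ h) (by positivity)

lemma cocycle_bound {κ : ℕ} (ζ : ℝ) (hζ : 1 < ζ) (γ : ℝ) (hγ : 0 < γ) (A : Sig κ → SL2)
    (M : ℝ) (hM1 : 1 ≤ M) (hM : ∀ x, opNorm (A x : Mat2) ≤ M) (hFB : FiberBunched ζ γ A) :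
    ∃ K t : ℝ, 0 < K ∧ 1 ≤ t ∧ t < ζ ^ γ ∧
      ∀ n x, opNorm ((cocycleN A n x : SL2) : Mat2) ^ 2 ≤ K * t ^ n := by
  obtain ⟨N, hN, c, hc, hb⟩ := hFB
  have hζ0 : 0 < ζ := by linarith
  have hc' : max c 1 < ζ ^ ((N : ℝ) * γ) :=
    max_lt hc (Real.one_lt_rpow hζ (by positivity))
  have hc1 : 1 ≤ max c 1 := le_max_right _ _
  have hN0 : (N : ℝ) ≠ 0 := by positivity
  have htN : ((max c 1) ^ ((N : ℝ)⁻¹)) ^ N = max c 1 :=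
    Real.rpow_inv_natCast_pow (by linarith) hN.ne'
  have ht1 : 1 ≤ (max c 1) ^ ((N : ℝ)⁻¹) := Real.one_le_rpow hc1 (by positivity)
  refine ⟨(M ^ N) ^ 2, (max c 1) ^ ((N : ℝ)⁻¹), by positivity, ht1, ?_, ?_⟩
  · refine lt_of_pow_lt_pow_left₀ N (by positivity) ?_
    rw [htN, ← Real.rpow_natCast, ← Real.rpow_mul hζ0.le, mul_comm γ]
    exact hc'
  · generalize (max c 1) ^ ((N : ℝ)⁻¹) = t at htN ht1
    have hsmall : ∀ n x, opNorm ((cocycleN A n x : SL2) : Mat2) ≤ M ^ n := by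
      intro n
      induction n with
      | zero => intro x; simp [cocycleN, opNorm_one]
      | succ n ih =>
        intro x
        rw [cocycleN, Matrix.SpecialLinearGroup.coe_mul, pow_succ]
        exact (opNorm_mul_le _ _).trans
          (mul_le_mul (ih _) (hM _) (opNorm_nonneg _) (by positivity))
    intro n
    induction n using Nat.strong_induction_on with
    | _ n ih =>
      intro x
      by_cases hn : n < N
      · calc _ ≤ (M ^ N) ^ 2 * 1 := by
              rw [mul_one]
              exact pow_le_pow_left₀ (opNorm_nonneg _)
                ((hsmall n x).trans (pow_le_pow_right₀ hM1 hn.le)) 2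
          _ ≤ _ := mul_le_mul_of_nonneg_left (one_le_pow₀ ht1) (by positivity)
      · obtain ⟨k, rfl⟩ : ∃ k, n = k + N := ⟨n - N, by omega⟩
        rw [cocycleN_add, Matrix.SpecialLinearGroup.coe_mul]
        calc _ ≤ (opNorm ((cocycleN A k (shift^[N] x) : SL2) : Mat2)
                * opNorm ((cocycleN A N x : SL2) : Mat2)) ^ 2 :=
              pow_le_pow_left₀ (opNorm_nonneg _) (opNorm_mul_le _ _) 2
          _ = opNorm ((cocycleN A k (shift^[N] x) : SL2) : Mat2) ^ 2
                * opNorm ((cocycleN A N x : SL2) : Mat2) ^ 2 := mul_pow _ _ _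
          _ ≤ ((M ^ N) ^ 2 * t ^ k) * t ^ N := by
              refine mul_le_mul (ih k (by omega) _) ?_ (by positivity) (by positivity)
              rw [htN]
              exact (hb x).trans (le_max_left _ _)
          _ = _ := by rw [pow_add]; ring

lemma exists_limit {κ : ℕ} (ζ : ℝ) (hζ : 1 < ζ)
    (γ : ℝ) (hγ : 0 < γ) (A : Sig κ → SL2)
    (hA : HolderCocycle ζ γ A) (hFB : FiberBunched ζ γ A) :
    ∃ L : ℝ, 0 < L ∧ ∀ x y, WsLoc x y → ∃ h : SL2,
      Filter.Tendsto (fun n : ℕ => ((cocycleN A n y)⁻¹ * cocycleN A n x : SL2))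
        Filter.atTop (nhds h) ∧
      opNorm ((h : Mat2) - 1) ≤ L * (dSig ζ x y) ^ γ := by
  have hζ0 : 0 < ζ := by linarith
  obtain ⟨B, hB⟩ := hA
  have hH : ∀ x y : Sig κ, opNorm ((A x : Mat2) - (A y : Mat2)) ≤ |B| * (dSig ζ x y) ^ γ := by
    intro x y
    by_cases e : x = y
    · subst e
      rw [sub_self]
      have : opNorm 0 = 0 := by simp [opNorm]
      rw [this]
      exact mul_nonneg (abs_nonneg _) (Real.rpow_nonneg (dSig_nonneg hζ _ _) _)
    · exact (hB x y e).trans (mul_le_mul_of_nonneg_right (le_abs_self B)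
        (Real.rpow_nonneg (dSig_nonneg hζ _ _) _))
  obtain ⟨M, hM1, hM⟩ : ∃ M : ℝ, 1 ≤ M ∧ ∀ x, opNorm (A x : Mat2) ≤ M := by
    by_cases hne : Nonempty (Sig κ)
    · obtain ⟨x0⟩ := hne
      refine ⟨max 1 (opNorm (A x0 : Mat2) + |B|), le_max_left _ _, fun x => ?_⟩
      refine le_trans ?_ (le_max_right _ _)
      have h1 : opNorm (A x : Mat2) ≤ opNorm (A x0 : Mat2)
          + opNorm ((A x : Mat2) - (A x0 : Mat2)) := by
        unfold opNorm
        rw [map_sub]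
        exact norm_le_norm_add_norm_sub' _ _
      have h2 := hH x x0
      have h3 : (dSig ζ x x0) ^ γ ≤ 1 :=
        Real.rpow_le_one (dSig_nonneg hζ _ _) (dSig_le_one hζ _ _) hγ.le
      have h4 := mul_le_mul_of_nonneg_left h3 (abs_nonneg B)
      linarith
    · exact ⟨1, le_rfl, fun x => (hne ⟨x⟩).elim⟩
  obtain ⟨K, t, hK, ht1, hts, hb⟩ := cocycle_bound ζ hζ γ hγ A M hM1 hM hFB
  set s := ζ ^ γ with hs
  have hs0 : 0 < s := by positivity
  have hr1 : t / s < 1 := (div_lt_one hs0).2 hts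
  refine ⟨K * M * |B| / (1 - t / s) + 1, ?_, ?_⟩
  · have : 0 < 1 - t / s := by linarith
    positivity
  intro x y hxy
  have hd0 : 0 ≤ dSig ζ x y ^ γ := Real.rpow_nonneg (dSig_nonneg hζ _ _) _
  let φ := Matrix.toEuclideanCLM (n := Fin 2) (𝕜 := ℝ)
  let f : ℕ → SL2 := fun n => (cocycleN A n y)⁻¹ * cocycleN A n x
  let u : ℕ → (E2 →L[ℝ] E2) := fun n => φ (f n : Mat2)
  have hstep : ∀ n, dist (u n) (u (n + 1)) ≤ (K * M * |B| * dSig ζ x y ^ γ) * (t / s) ^ n := by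
    intro n
    rw [dist_comm, dist_eq_norm, ← map_sub]
    change opNorm _ ≤ _
    have e : ((f (n + 1) : SL2) : Mat2) - (f n : Mat2) =
        (((cocycleN A n y)⁻¹ : SL2) : Mat2) * ((((A (shift^[n] y))⁻¹ : SL2) : Mat2) *
          ((A (shift^[n] x) : Mat2) - (A (shift^[n] y) : Mat2))) * (cocycleN A n x : Mat2) := by
      have e1 : (((A (shift^[n] y))⁻¹ : SL2) : Mat2) * (A (shift^[n] y) : Mat2) = 1 := by
        rw [← Matrix.SpecialLinearGroup.coe_mul, inv_mul_cancel,
          Matrix.SpecialLinearGroup.coe_one]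
      rw [mul_sub, e1]
      simp only [f, cocycleN_succ', mul_inv_rev, Matrix.SpecialLinearGroup.coe_mul]
      noncomm_ring
    rw [e]
    set p := opNorm (cocycleN A n y : Mat2)
    set q := opNorm (cocycleN A n x : Mat2)
    have hp : p ^ 2 ≤ K * t ^ n := hb n y
    have hq : q ^ 2 ≤ K * t ^ n := hb n x
    have hp0 : 0 ≤ p := opNorm_nonneg _
    have hq0 : 0 ≤ q := opNorm_nonneg _
    have hpq : p * q ≤ K * t ^ n := by nlinarith [sq_nonneg (p - q)]
    have hd : dSig ζ (shift^[n] x) (shift^[n] y) ^ γ ≤ (s ^ n)⁻¹ * dSig ζ x y ^ γ := by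
      refine (Real.rpow_le_rpow (dSig_nonneg hζ _ _) (dSig_iter hζ n hxy) hγ.le).trans ?_
      rw [Real.mul_rpow (by positivity) (dSig_nonneg hζ _ _), hs, ← inv_pow,
        ← Real.inv_rpow hζ0.le, ← Real.rpow_natCast, ← Real.rpow_natCast,
        ← Real.rpow_mul (by positivity), ← Real.rpow_mul (by positivity), mul_comm γ]
    calc _ ≤ (opNorm (((cocycleN A n y)⁻¹ : SL2) : Mat2) *
            (opNorm (((A (shift^[n] y))⁻¹ : SL2) : Mat2) *
            opNorm ((A (shift^[n] x) : Mat2) - (A (shift^[n] y) : Mat2)))) * q := by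
          refine (opNorm_mul_le _ _).trans (mul_le_mul_of_nonneg_right ?_ hq0)
          refine (opNorm_mul_le _ _).trans (mul_le_mul_of_nonneg_left ?_ (opNorm_nonneg _))
          exact opNorm_mul_le _ _
      _ ≤ (p * (M * (|B| * ((s ^ n)⁻¹ * dSig ζ x y ^ γ)))) * q := by
          refine mul_le_mul_of_nonneg_right ?_ hq0
          refine mul_le_mul (opNorm_inv_le _) ?_
            (mul_nonneg (opNorm_nonneg _) (opNorm_nonneg _)) hp0
          refine mul_le_mul ((opNorm_inv_le _).trans (hM _)) ?_ (opNorm_nonneg _) (by linarith)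
          exact (hH _ _).trans (mul_le_mul_of_nonneg_left hd (abs_nonneg _))
      _ = (p * q) * (M * (|B| * ((s ^ n)⁻¹ * dSig ζ x y ^ γ))) := by ring
      _ ≤ (K * t ^ n) * (M * (|B| * ((s ^ n)⁻¹ * dSig ζ x y ^ γ))) :=
          mul_le_mul_of_nonneg_right hpq (by positivity)
      _ = _ := by rw [div_pow]; ring
  obtain ⟨a, ha⟩ := cauchySeq_tendsto_of_complete (cauchySeq_of_le_geometric _ _ hr1 hstep)
  have hdist := dist_le_of_le_geometric_of_tendsto₀ _ _ hr1 hstep ha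
  have hcont : Continuous (φ.symm : (E2 →L[ℝ] E2) → Mat2) :=
    LinearMap.continuous_of_finiteDimensional
      (φ.symm.toAlgEquiv.toLinearMap : (E2 →L[ℝ] E2) →ₗ[ℝ] Mat2)
  have hlim : Filter.Tendsto (fun n => (f n : Mat2)) Filter.atTop (nhds (φ.symm a)) := by
    have := (hcont.tendsto a).comp ha
    refine this.congr fun n => ?_
    exact φ.symm_apply_apply _
  have hdet : (φ.symm a).det = 1 := by
    have h1 : Filter.Tendsto (fun n => (f n : Mat2).det) Filter.atTop
        (nhds (φ.symm a).det) :=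
      ((continuous_id.matrix_det).tendsto (φ.symm a)).comp hlim
    have h2 : (fun n => (f n : Mat2).det) = fun _ => (1 : ℝ) := by
      funext n
      exact (f n).2
    rw [h2] at h1
    exact tendsto_nhds_unique h1 tendsto_const_nhds
  refine ⟨⟨φ.symm a, hdet⟩, ?_, ?_⟩
  · exact tendsto_subtype_rng.2 hlim
  · have e : opNorm (φ.symm a - 1) = dist (u 0) a := by
      rw [dist_comm, dist_eq_norm]
      unfold opNorm
      rw [map_sub]
      change ‖φ (φ.symm a) - _‖ = _
      rw [φ.apply_symm_apply]
      simp [u, f, cocycleN, φ]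
    change opNorm (φ.symm a - 1) ≤ _
    rw [e]
    refine hdist.trans ?_
    rw [add_mul, one_mul, div_mul_eq_mul_div]
    linarith

/-- **Existence of stable linear holonomies for fiber-bunched cocycles.**
If `A ∈ C^γ(Σ, SL₂(ℝ))` is γ-fiber bunched, then for `y ∈ W^s_loc(x)` the limits
`H^s_{x,y} = lim_n (A^n(y))⁻¹ A^n(x)` exist, satisfy a Hölder bound
`‖H^s_{x,y} − Id‖ ≤ L d(x,y)^γ`, and form a family of stable holonomies. -/
theorem stable_holonomies {κ : ℕ} (hκ : 2 ≤ κ) (ζ : ℝ) (hζ : 1 < ζ)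
    (γ : ℝ) (hγ : 0 < γ) (A : Sig κ → SL2)
    (hA : HolderCocycle ζ γ A) (hFB : FiberBunched ζ γ A) :
    ∃ H : Sig κ → Sig κ → SL2,
      (∀ x y, WsLoc x y → Filter.Tendsto
        (fun n : ℕ => ((cocycleN A n y)⁻¹ * cocycleN A n x : SL2))
        Filter.atTop (nhds (H x y))) ∧
      (∃ L : ℝ, 0 < L ∧ ∀ x y, WsLoc x y →
        opNorm ((H x y : Mat2) - 1) ≤ L * (dSig ζ x y) ^ γ) ∧
      (∀ x, H x x = 1) ∧
      (∀ x y z, WsLoc x y → WsLoc x z → H x y = H z y * H x z) ∧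
      (∀ x y, WsLoc x y → H (shift x) (shift y) = A y * H x y * (A x)⁻¹) := by
  obtain ⟨L, hL, hex⟩ := exists_limit ζ hζ γ hγ A hA hFB
  choose! H hH hbd using hex
  have hcoe : Continuous (fun g : SL2 => (g : Mat2)) := continuous_subtype_val
  have hlim : ∀ x y, WsLoc x y → Filter.Tendsto
      (fun n : ℕ => (((cocycleN A n y)⁻¹ * cocycleN A n x : SL2) : Mat2))
      Filter.atTop (nhds (H x y : Mat2)) := fun x y h => (hcoe.tendsto _).comp (hH x y h)
  refine ⟨H, hH, ⟨L, hL, hbd⟩, ?_, ?_, ?_⟩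
  · intro x
    apply Subtype.ext
    refine tendsto_nhds_unique (hlim x x fun _ _ => rfl) ?_
    simp only [inv_mul_cancel]
    exact tendsto_const_nhds
  · intro x y z hxy hxz
    apply Subtype.ext
    refine tendsto_nhds_unique (hlim x y hxy) ?_
    have hzy : WsLoc z y := fun n hn => (hxy n hn).trans (hxz n hn).symm
    have := (hlim z y hzy).mul (hlim x z hxz)
    rw [← Matrix.SpecialLinearGroup.coe_mul] at this
    refine this.congr fun n => ?_
    rw [← Matrix.SpecialLinearGroup.coe_mul]
    congr 1
    simp [mul_assoc]
    rfl
  · intro x y hxy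
    apply Subtype.ext
    refine tendsto_nhds_unique (hlim _ _ hxy.shift') ?_
    have h1 := (Filter.tendsto_add_atTop_iff_nat 1).2 (hlim x y hxy)
    have := (h1.const_mul (A y : Mat2)).mul_const (((A x)⁻¹ : SL2) : Mat2)
    rw [← Matrix.SpecialLinearGroup.coe_mul, ← Matrix.SpecialLinearGroup.coe_mul] at this
    refine this.congr fun n => ?_
    rw [← Matrix.SpecialLinearGroup.coe_mul, ← Matrix.SpecialLinearGroup.coe_mul]
    congr 1
    simp [cocycleN, mul_assoc]
    rfl
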